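/- Let π^trig_± denote the projections onto A^trig_λ(g) and ι_λ R_λ(g) relative to the direct sum decomposition A_λ(g) = A^trig_λ(g) ∔ ι_λ R_λ(g). Then for any adelic element X ∈ A_λ(g) and any a ∈ ℂP¹, the components of the projections are given by the residue formulas (π^trig₊X)^a(λ_a) = Σ_{b∈ℂP¹} res^μ_b Tr₂( ι_{μ_b} ι_{λ_a} r^trig₁₂(λ,μ) X^b(μ_b)₂ ) μ^{-1} dμ and (π^trig₋X)^a(λ_a) = −Σ_{b∈ℂP¹} res^μ_b Tr₂( ι_{λ_a} ι_{μ_b} r^trig₁₂(λ,μ) X^b(μ_b)₂ ) μ^{-1} dμ, where the factor μ^{-1} is implicitly expanded at b. -/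

import Mathlib

/-!
# Residue formulas for the projections `π^trig_±` (trigonometric case)

Relative to `A_λ(g) = A^trig_λ(g) ∔ ι_λ R_λ(g)`, the projections of an adelic element `X`
are given by
`(π^trig₊X)^a(λ_a) = Σ_b res^μ_b Tr₂( ι_{μ_b}ι_{λ_a} r^trig₁₂(λ,μ) X^b(μ_b)₂ ) μ^{-1} dμ`,
`(π^trig₋X)^a(λ_a) = −Σ_b res^μ_b Tr₂( ι_{λ_a}ι_{μ_b} r^trig₁₂(λ,μ) X^b(μ_b)₂ ) μ^{-1} dμ`,
with the factor `μ^{-1}` expanded at `b`.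

Using `Tr₂(P₁₂M₂) = M`, `Tr₂(P⁻₁₂M₂) = P⁻M` (strictly lower part), `Tr₂(P⁰₁₂M₂) = P⁰M`
(diagonal part), the integrand is
`(double expansion of μ/(μ−λ)) · X^b(μ_b) − (P⁻ + ½P⁰)X^b(μ_b)`,
where the constant part `−(P⁻+½P⁰)X^b(μ_b)` is independent of `λ` (only the `λ_a^0`
coefficient is nonzero, its expansion being the same in both orders).
-/

set_option synthInstance.maxHeartbeats 400000
noncomputable section
open Polynomial

abbrev Rf : Type := RatFunc ℂ
abbrev Rf2 : Type := RatFunc Rf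
/-- `ℂP¹ = ℂ ∪ {∞}`; `none` is the point at infinity -/
abbrev CP1 : Type := Option ℂ
abbrev glC (N : ℕ) : Type := Matrix (Fin N) (Fin N) ℂ
abbrev AdeleData (N : ℕ) : Type := CP1 → ℤ → glC N

def laurentCoeffAt {F : Type*} [Field F] (b : F) (f : RatFunc F) (n : ℤ) : F :=
  ((RatFunc.laurent b f : LaurentSeries F)).coeff n

def invSubst {F : Type*} [Field F] (f : RatFunc F) : RatFunc F :=
  (algebraMap F[X] (RatFunc F) f.num.reverse * RatFunc.X ^ f.denom.natDegree) /
    (algebraMap F[X] (RatFunc F) f.denom.reverse * RatFunc.X ^ f.num.natDegree)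

/-- `ι_{λ_a}`: coefficient of `λ_a^n` in the Laurent expansion at `a ∈ ℂP¹` -/
def expC {F : Type*} [Field F] (a : Option F) (f : RatFunc F) (n : ℤ) : F :=
  match a with
  | some b => laurentCoeffAt b f n
  | none => ((invSubst f : LaurentSeries F)).coeff n

def pt (b : CP1) : Option Rf := b.map (algebraMap ℂ Rf)

/-- the scalar kernel `μ/(μ−λ)` of the trigonometric r-matrix, outer variable `μ` -/
def sMuOuter : Rf2 := RatFunc.X * (RatFunc.X - RatFunc.C (RatFunc.X : Rf))⁻¹
/-- the scalar kernel `μ/(μ−λ)`, outer variable `λ` -/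
def sLamOuter : Rf2 := RatFunc.C (RatFunc.X : Rf) * (RatFunc.C (RatFunc.X : Rf) - RatFunc.X)⁻¹

/-- `ι_{λ_a}ι_{μ_b}(μ/(μ−λ))` : coefficient of `λ_a^t μ_b^m`, expanding first in `μ_b` -/
def sMuFirst (a b : CP1) (t m : ℤ) : ℂ := expC a (expC (pt b) sMuOuter m) t
/-- `ι_{μ_b}ι_{λ_a}(μ/(μ−λ))` : coefficient of `λ_a^t μ_b^m`, expanding first in `λ_a` -/
def sLamFirst (a b : CP1) (t m : ℤ) : ℂ := expC b (expC (pt a) sLamOuter t) m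

/-- residue of `(Σ_n c_n μ_b^n) dμ` at `b`; at `∞`, `dμ = -μ_∞^{-2} dμ_∞` -/
def res {V : Type*} [AddCommGroup V] (b : CP1) (c : ℤ → V) : V :=
  match b with
  | some _ => c (-1)
  | none => - c 1

def lowP {N : ℕ} (M : glC N) : glC N := Matrix.of fun i j => if j < i then M i j else 0
def upP {N : ℕ} (M : glC N) : glC N := Matrix.of fun i j => if i < j then M i j else 0
def diagP {N : ℕ} (M : glC N) : glC N := Matrix.of fun i j => if i = j then M i j else 0

def LaurentBdd {N : ℕ} (X : AdeleData N) : Prop := ∀ a, ∃ M : ℤ, ∀ n, n < M → X a n = 0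
def AlmostTaylor {N : ℕ} (X : AdeleData N) : Prop := {a : CP1 | ∃ n, n < 0 ∧ X a n ≠ 0}.Finite
def IsAdele {N : ℕ} (X : AdeleData N) : Prop := LaurentBdd X ∧ AlmostTaylor X

/-- membership in `A^trig_λ(g)` -/
def InAtrig {N : ℕ} (X : AdeleData N) : Prop :=
  (∀ a n, n < 0 → X a n = 0) ∧ lowP (X (some 0) 0) = 0 ∧ upP (X none 0) = 0 ∧
    diagP (X (some 0) 0) = - diagP (X none 0)

def iota {N : ℕ} (f : Matrix (Fin N) (Fin N) Rf) : AdeleData N :=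
  fun a n => Matrix.of fun i j => expC a (f i j) n

/-- `Tr₂( ι_{μ_b}ι_{λ_a} r^trig₁₂(λ,μ) X^b(μ_b)₂ )`, coefficient of `λ_a^t μ_b^m`
(expanding first in `λ_a`, then in `μ_b`) -/
def trigIntP {N : ℕ} (X : AdeleData N) (a b : CP1) (t m : ℤ) : glC N :=
  (∑ᶠ p : ℤ, sLamFirst a b t p • X b (m - p))
    - (if t = 0 then lowP (X b m) + (2:ℂ)⁻¹ • diagP (X b m) else 0)

/-- `Tr₂( ι_{λ_a}ι_{μ_b} r^trig₁₂(λ,μ) X^b(μ_b)₂ )`, coefficient of `λ_a^t μ_b^m`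
(expanding first in `μ_b`, then in `λ_a`) -/
def trigIntM {N : ℕ} (X : AdeleData N) (a b : CP1) (t m : ℤ) : glC N :=
  (∑ᶠ p : ℤ, sMuFirst a b t p • X b (m - p))
    - (if t = 0 then lowP (X b m) + (2:ℂ)⁻¹ • diagP (X b m) else 0)

/-- right-hand side of the `π^trig₊` formula: the integrand is further multiplied by the
expansion of `μ^{-1}` at `b`, then the residue in `μ` is taken and summed over `b` -/
def projPlusTrigRHS {N : ℕ} (X : AdeleData N) (a : CP1) (t : ℤ) : glC N :=
  ∑ᶠ b : CP1, res b (fun m : ℤ =>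
    ∑ᶠ p : ℤ, expC b ((RatFunc.X : Rf)⁻¹) p • trigIntP X a b t (m - p))

/-- right-hand side of the `π^trig₋` formula -/
def projMinusTrigRHS {N : ℕ} (X : AdeleData N) (a : CP1) (t : ℤ) : glC N :=
  - ∑ᶠ b : CP1, res b (fun m : ℤ =>
    ∑ᶠ p : ℤ, expC b ((RatFunc.X : Rf)⁻¹) p • trigIntM X a b t (m - p))

section Expansions

variable {F : Type*} [Field F]

theorem eval₂_C_X_eq_algebraMap (p : F[X]) :
    Polynomial.eval₂ (RatFunc.C : F →+* RatFunc F) RatFunc.X p = algebraMap F[X] (RatFunc F) p := by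
  rw [← RatFunc.algebraMap_comp_C, ← RatFunc.algebraMap_X, ← Polynomial.hom_eval₂,
    Polynomial.eval₂_C_X]

theorem algebraMap_reverse (p : F[X]) :
    algebraMap F[X] (RatFunc F) p.reverse =
      Polynomial.eval₂ (RatFunc.C : F →+* RatFunc F) RatFunc.X⁻¹ p * RatFunc.X ^ p.natDegree := by
  have : Invertible (RatFunc.X : RatFunc F)⁻¹ :=
    invertibleOfNonzero (inv_ne_zero RatFunc.X_ne_zero)
  have h := Polynomial.eval₂_reverse_mul_pow (RatFunc.C : F →+* RatFunc F) RatFunc.X⁻¹ p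
  rw [invOf_eq_inv, inv_inv, eval₂_C_X_eq_algebraMap] at h
  rw [← h, mul_assoc, ← mul_pow, inv_mul_cancel₀ RatFunc.X_ne_zero, one_pow, mul_one]

/-- The substitution `X ↦ X⁻¹` on rational functions. -/
def ratInv (F : Type*) [Field F] : RatFunc F →+* RatFunc F :=
  RatFunc.liftRingHom (Polynomial.eval₂RingHom (RatFunc.C : F →+* RatFunc F) RatFunc.X⁻¹) (by
    intro p hp
    rw [Submonoid.mem_comap, mem_nonZeroDivisors_iff_ne_zero]
    rw [mem_nonZeroDivisors_iff_ne_zero] at hp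
    intro h
    have h1 := algebraMap_reverse p
    rw [Polynomial.coe_eval₂RingHom] at h
    rw [h, zero_mul] at h1
    exact hp (by simpa using h1))

theorem ratInv_X : ratInv F RatFunc.X = RatFunc.X⁻¹ := by
  simp [ratInv]

theorem ratInv_C (c : F) : ratInv F (RatFunc.C c) = RatFunc.C c := by
  simp [ratInv]

theorem invSubst_eq_ratInv (f : RatFunc F) : invSubst f = ratInv F f := by
  conv_rhs => rw [← RatFunc.num_div_denom f]
  rw [ratInv, RatFunc.liftRingHom_apply_div, invSubst, algebraMap_reverse, algebraMap_reverse,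
    Polynomial.coe_eval₂RingHom]
  have hX := pow_ne_zero f.num.natDegree (RatFunc.X_ne_zero (K := F))
  have hX' := pow_ne_zero f.denom.natDegree (RatFunc.X_ne_zero (K := F))
  rw [mul_assoc, mul_assoc, mul_comm (RatFunc.X ^ f.denom.natDegree)]
  exact mul_div_mul_right _ _ (mul_ne_zero hX hX')

open scoped RatFunc in
/-- The expansion at the origin as a ring homomorphism. -/
def expZero (F : Type*) [Field F] : RatFunc F →+* LaurentSeries F :=
  algebraMap (RatFunc F) (LaurentSeries F)

theorem expZero_X : expZero F RatFunc.X = HahnSeries.single 1 1 :=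
  RatFunc.coe_X

theorem expZero_C (c : F) : expZero F (RatFunc.C c) = HahnSeries.C c := by
  have h := RatFunc.coe_coe (Polynomial.C c)
  rw [Polynomial.coe_C, PowerSeries.coe_C] at h
  exact h.symm

/-- The Laurent expansion at a point of the projective line, as a ring homomorphism. -/
def expL (a : Option F) : RatFunc F →+* LaurentSeries F :=
  match a with
  | some b => (expZero F).comp (RatFunc.laurent b : RatFunc F →+* RatFunc F)
  | none => (expZero F).comp (ratInv F)

theorem expC_eq_coeff (a : Option F) (f : RatFunc F) (n : ℤ) :
    expC a f n = (expL a f).coeff n := by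
  cases a with
  | none => simp only [expC, expL, invSubst_eq_ratInv]; rfl
  | some b => rfl

theorem expL_C (a : Option F) (c : F) : expL a (RatFunc.C c) = HahnSeries.C c := by
  cases a with
  | none => simp [expL, ratInv_C, expZero_C]
  | some b => simp [expL, RatFunc.laurent_C, expZero_C]

theorem expL_some_X (a : F) :
    expL (some a) RatFunc.X = HahnSeries.single 1 1 + HahnSeries.C a := by
  simp [expL, RatFunc.laurent_X, expZero_C, expZero_X]

theorem expL_none_X : expL (none : Option F) RatFunc.X = HahnSeries.single (-1) 1 := by
  simp [expL, ratInv_X, expZero_X, HahnSeries.inv_single]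

theorem inv_C_sub_single {c : F} (hc : c ≠ 0) :
    (HahnSeries.C c - HahnSeries.single (1 : ℤ) 1)⁻¹ =
      HahnSeries.ofPowerSeries ℤ F (PowerSeries.mk fun n => (c ^ (n + 1))⁻¹) := by
  have h : (PowerSeries.C c - PowerSeries.X) * (PowerSeries.mk fun n => (c ^ (n + 1))⁻¹) = 1 := by
    ext n
    cases n with
    | zero => simp [sub_mul, hc]
    | succ n =>
      rw [sub_mul, map_sub, PowerSeries.coeff_C_mul, PowerSeries.coeff_succ_X_mul]
      simp only [PowerSeries.coeff_mk, PowerSeries.coeff_one, Nat.add_eq_zero_iff, one_ne_zero,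
        and_false, if_false]
      field_simp
      ring
  have h2 := congrArg (HahnSeries.ofPowerSeries ℤ F) h
  rw [map_mul, map_sub, HahnSeries.ofPowerSeries_C, HahnSeries.ofPowerSeries_X,
    map_one (HahnSeries.ofPowerSeries ℤ F)] at h2
  exact (eq_inv_of_mul_eq_one_right h2).symm

theorem inv_one_sub_C_mul_single (c : F) :
    (1 - HahnSeries.C c * HahnSeries.single (1 : ℤ) 1)⁻¹ =
      HahnSeries.ofPowerSeries ℤ F (PowerSeries.mk fun n => c ^ n) := by
  have h : (1 - PowerSeries.C c * PowerSeries.X) * (PowerSeries.mk fun n => c ^ n) = 1 := by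
    ext n
    cases n with
    | zero => simp [sub_mul, mul_assoc]
    | succ n =>
      rw [sub_mul, map_sub, mul_assoc, PowerSeries.coeff_C_mul, PowerSeries.coeff_succ_X_mul]
      simp [PowerSeries.coeff_one, pow_succ']
  have h2 := congrArg (HahnSeries.ofPowerSeries ℤ F) h
  rw [map_mul, map_sub, map_mul, HahnSeries.ofPowerSeries_C, HahnSeries.ofPowerSeries_X,
    map_one (HahnSeries.ofPowerSeries ℤ F)] at h2
  exact (eq_inv_of_mul_eq_one_right h2).symm

end Expansions

section Kernel

/-- The coefficient of `λ_a^t` in the expansion of `μ/(μ−λ)`, as a rational function of `μ`. -/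
def kernelCoeff (a : CP1) (t : ℤ) : Rf :=
  expC (pt a) sLamOuter t

theorem ratX_sub_C_ne_zero (a : ℂ) : (RatFunc.X : Rf) - RatFunc.C a ≠ 0 := by
  rw [← RatFunc.algebraMap_X, ← RatFunc.algebraMap_C, ← map_sub]
  exact RatFunc.algebraMap_ne_zero (Polynomial.X_sub_C_ne_zero a)

theorem kernelCoeff_some (a : ℂ) (t : ℤ) :
    kernelCoeff (some a) t =
      if t < 0 then 0 else RatFunc.X * ((RatFunc.X - RatFunc.C a) ^ (t.natAbs + 1))⁻¹ := by
  have h : expL (pt (some a)) sLamOuter =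
      HahnSeries.C (RatFunc.X : Rf) *
        (HahnSeries.C ((RatFunc.X : Rf) - RatFunc.C a) - HahnSeries.single 1 1)⁻¹ := by
    rw [sLamOuter, map_mul, map_inv₀, map_sub, pt, Option.map_some, expL_C, expL_some_X,
      RatFunc.algebraMap_eq_C, map_sub]
    congr 2
    ring
  rw [kernelCoeff, expC_eq_coeff, h, inv_C_sub_single (ratX_sub_C_ne_zero a), HahnSeries.C_mul_eq_smul,
    HahnSeries.coeff_smul, PowerSeries.coeff_coe, PowerSeries.coeff_mk]
  split_ifs <;> simp

theorem kernelCoeff_none (t : ℤ) :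
    kernelCoeff none t = if t ≤ 0 then 0 else - RatFunc.X ^ t.natAbs := by
  have h : expL (pt none) sLamOuter =
      1 - (1 - HahnSeries.C (RatFunc.X : Rf) * HahnSeries.single 1 1)⁻¹ := by
    rw [sLamOuter, map_mul, map_inv₀, map_sub, pt, Option.map_none, expL_C, expL_none_X]
    have hs : HahnSeries.single (-1 : ℤ) (1 : Rf) * HahnSeries.single 1 1 = 1 := by
      simp
    have hs0 : HahnSeries.single (-1 : ℤ) (1 : Rf) ≠ 0 := by simp
    have h1 : 1 - HahnSeries.C (RatFunc.X : Rf) * HahnSeries.single (1 : ℤ) 1 ≠ 0 := by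
      intro h0
      have := congrArg (fun S => HahnSeries.coeff S 0) h0
      simp at this
    have h2 : HahnSeries.C (RatFunc.X : Rf) - HahnSeries.single (-1 : ℤ) 1 =
        - (HahnSeries.single (-1 : ℤ) (1 : Rf) *
          (1 - HahnSeries.C (RatFunc.X : Rf) * HahnSeries.single (1 : ℤ) 1)) := by
      linear_combination (-HahnSeries.C (RatFunc.X : Rf)) * hs
    have h3 : HahnSeries.C (RatFunc.X : Rf) - HahnSeries.single (-1 : ℤ) 1 ≠ 0 := by
      rw [h2]
      exact neg_ne_zero.2 (mul_ne_zero hs0 h1)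
    rw [h2] at h3 ⊢
    field_simp
    linear_combination (HahnSeries.C (RatFunc.X : Rf)) * hs
  rw [kernelCoeff, expC_eq_coeff, h, inv_one_sub_C_mul_single,
    HahnSeries.coeff_sub, PowerSeries.coeff_coe, PowerSeries.coeff_mk, HahnSeries.coeff_one]
  rcases lt_trichotomy t 0 with ht | rfl | ht
  · simp [ht, ht.ne, ht.le]
  · simp
  · simp [ht.not_gt, ht.ne', ht.not_ge]

theorem mul_inv_sub_eq_one_sub {K : Type*} [Field K] {x y : K} (h : x - y ≠ 0) :
    x * (x - y)⁻¹ = 1 - y * (y - x)⁻¹ := by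
  rw [← neg_sub x y, inv_neg]
  field_simp
  ring

theorem sMuOuter_eq : sMuOuter = 1 - sLamOuter := by
  refine mul_inv_sub_eq_one_sub (K := Rf2) ?_
  rw [← RatFunc.algebraMap_X, ← RatFunc.algebraMap_C, ← map_sub]
  exact RatFunc.algebraMap_ne_zero (Polynomial.X_sub_C_ne_zero _)

theorem sLamFirst_eq (a b : CP1) (t m : ℤ) :
    sLamFirst a b t m = (expL b (kernelCoeff a t)).coeff m :=
  expC_eq_coeff _ _ _

theorem sMuFirst_eq (a b : CP1) (t m : ℤ) :
    sMuFirst a b t m = (if m = 0 ∧ t = 0 then 1 else 0) - sLamFirst b a m t := by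
  rw [sMuFirst, sMuOuter_eq, expC_eq_coeff, expC_eq_coeff, map_sub, map_one, HahnSeries.coeff_sub,
    map_sub, HahnSeries.coeff_sub, sLamFirst_eq, kernelCoeff, expC_eq_coeff, HahnSeries.coeff_one]
  congr 1
  split_ifs <;> simp_all

end Kernel

section Residues

/-- The subring of power series inside Laurent series. -/
def taylorSubring (F : Type*) [Field F] : Subring (LaurentSeries F) :=
  (HahnSeries.ofPowerSeries ℤ F).range

theorem coeff_eq_zero_of_mem_taylorSubring {F : Type*} [Field F] {S : LaurentSeries F}
    (hS : S ∈ taylorSubring F) {n : ℤ} (hn : n < 0) : S.coeff n = 0 := by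
  obtain ⟨p, rfl⟩ := hS
  rw [PowerSeries.coeff_coe, if_pos hn]

theorem C_mem_taylorSubring {F : Type*} [Field F] (c : F) :
    HahnSeries.C c ∈ taylorSubring F :=
  ⟨PowerSeries.C c, HahnSeries.ofPowerSeries_C c⟩

theorem single_one_mem_taylorSubring {F : Type*} [Field F] :
    HahnSeries.single (1 : ℤ) (1 : F) ∈ taylorSubring F :=
  ⟨PowerSeries.X, HahnSeries.ofPowerSeries_X⟩

theorem expL_some_X_mem (b : ℂ) : expL (some b) RatFunc.X ∈ taylorSubring ℂ := by
  rw [expL_some_X]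
  exact add_mem single_one_mem_taylorSubring (C_mem_taylorSubring b)

theorem expL_pole_same (a : ℂ) (n : ℕ) :
    expL (some a) (((RatFunc.X : Rf) - RatFunc.C a) ^ (n + 1))⁻¹ =
      HahnSeries.single (-(n + 1 : ℤ)) 1 := by
  rw [map_inv₀, map_pow, map_sub, expL_some_X, expL_C, add_sub_cancel_right,
    HahnSeries.single_pow, HahnSeries.inv_single]
  simp

theorem expL_pole_of_ne {a b : ℂ} (h : b ≠ a) (n : ℕ) :
    expL (some b) (((RatFunc.X : Rf) - RatFunc.C a) ^ n)⁻¹ ∈ taylorSubring ℂ := by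
  rw [← inv_pow, map_pow]
  refine pow_mem ?_ _
  have h1 : expL (some b) ((RatFunc.X : Rf) - RatFunc.C a) =
      -(HahnSeries.C (a - b) - HahnSeries.single 1 1) := by
    rw [map_sub, expL_some_X, expL_C, map_sub]
    ring
  rw [map_inv₀, h1, inv_neg, inv_C_sub_single (sub_ne_zero.2 h.symm)]
  exact neg_mem ⟨_, rfl⟩

theorem expL_none_pole (a : ℂ) (n : ℕ) :
    ∃ q : PowerSeries ℂ, PowerSeries.constantCoeff q = 1 ∧
      expL none (((RatFunc.X : Rf) - RatFunc.C a) ^ n)⁻¹ =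
        HahnSeries.single (n : ℤ) 1 * HahnSeries.ofPowerSeries ℤ ℂ q := by
  refine ⟨(PowerSeries.mk fun k => a ^ k) ^ n, by simp, ?_⟩
  have h1 : expL none ((RatFunc.X : Rf) - RatFunc.C a) =
      HahnSeries.single (-1) 1 * (1 - HahnSeries.C a * HahnSeries.single (1 : ℤ) 1) := by
    have hs : HahnSeries.single (-1 : ℤ) (1 : ℂ) * HahnSeries.single 1 1 = 1 := by simp
    rw [map_sub, expL_none_X, expL_C]
    linear_combination HahnSeries.C a * hs
  rw [← inv_pow, map_pow, map_inv₀, h1, mul_inv, inv_one_sub_C_mul_single, mul_pow,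
    HahnSeries.inv_single, HahnSeries.single_pow, map_pow (HahnSeries.ofPowerSeries ℤ ℂ)]
  simp

theorem expL_none_X_pow (n : ℕ) :
    expL none ((RatFunc.X : Rf) ^ n) = HahnSeries.single (-(n : ℤ)) 1 := by
  rw [map_pow, expL_none_X, HahnSeries.single_pow]
  simp

/-- The residue at `b` of a Laurent series times `dμ`. -/
def resL (b : CP1) (S : LaurentSeries ℂ) : ℂ := res b S.coeff

theorem resL_add (b : CP1) (S T : LaurentSeries ℂ) : resL b (S + T) = resL b S + resL b T := by
  cases b <;> simp [resL, res, add_comm]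

theorem resL_C_mul (b : CP1) (c : ℂ) (S : LaurentSeries ℂ) :
    resL b (HahnSeries.C c * S) = c * resL b S := by
  cases b <;> simp [resL, res]

theorem resL_some_of_mem (b : ℂ) {S : LaurentSeries ℂ} (hS : S ∈ taylorSubring ℂ) :
    resL (some b) S = 0 :=
  coeff_eq_zero_of_mem_taylorSubring hS (by norm_num)

/-- The sum of the residues of `G · Z dμ` over the projective line is finite and equals `v`. -/
def HasResidueSum (Z : CP1 → LaurentSeries ℂ) (G : Rf) (v : ℂ) : Prop :=
  (Function.support fun b => resL b (expL b G * Z b)).Finite ∧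
    ∑ᶠ b, resL b (expL b G * Z b) = v

theorem HasResidueSum.add {Z : CP1 → LaurentSeries ℂ} {G H : Rf} {v w : ℂ}
    (hG : HasResidueSum Z G v) (hH : HasResidueSum Z H w) : HasResidueSum Z (G + H) (v + w) := by
  have h : (fun b => resL b (expL b (G + H) * Z b)) =
      fun b => resL b (expL b G * Z b) + resL b (expL b H * Z b) := by
    funext b
    rw [map_add, add_mul, resL_add]
  refine ⟨?_, ?_⟩
  · rw [h]
    exact (hG.1.union hH.1).subset (Function.support_add _ _)
  · rw [h, finsum_add_distrib hG.1 hH.1, hG.2, hH.2]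

theorem HasResidueSum.C_mul {Z : CP1 → LaurentSeries ℂ} {G : Rf} {v : ℂ} (c : ℂ)
    (hG : HasResidueSum Z G v) : HasResidueSum Z (RatFunc.C c * G) (c * v) := by
  have h : (fun b => resL b (expL b (RatFunc.C c * G) * Z b)) =
      fun b => c * resL b (expL b G * Z b) := by
    funext b
    rw [map_mul, mul_assoc, expL_C, resL_C_mul]
  refine ⟨?_, ?_⟩
  · rw [h]
    refine hG.1.subset fun b hb => ?_
    rw [Function.mem_support] at hb ⊢
    exact right_ne_zero_of_mul hb
  · rw [h, ← hG.2]
    exact ((AddMonoidHom.mulLeft c).map_finsum hG.1).symm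

theorem HasResidueSum.zero (Z : CP1 → LaurentSeries ℂ) : HasResidueSum Z 0 0 := by
  have h : (fun b => resL b (expL b 0 * Z b)) = fun _ => 0 := by
    funext b
    cases b <;> simp [resL, res]
  rw [HasResidueSum, h]
  simp

theorem HasResidueSum.pole (z : CP1 → PowerSeries ℂ) (a : ℂ) (n : ℕ) :
    HasResidueSum (fun b => HahnSeries.ofPowerSeries ℤ ℂ (z b))
      (((RatFunc.X : Rf) - RatFunc.C a) ^ (n + 1))⁻¹
      (PowerSeries.coeff n (z (some a)) -
        if n = 0 then PowerSeries.constantCoeff (z none) else 0) := by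
  have hsupp : (Function.support fun b => resL b
      (expL b (((RatFunc.X : Rf) - RatFunc.C a) ^ (n + 1))⁻¹ *
        HahnSeries.ofPowerSeries ℤ ℂ (z b))) ⊆ (({some a, none} : Finset CP1) : Set CP1) := by
    intro b hb
    rw [Function.mem_support] at hb
    cases b with
    | none => simp
    | some b =>
      by_cases hba : b = a
      · simp [hba]
      · exact absurd (resL_some_of_mem b (mul_mem (expL_pole_of_ne hba _) ⟨_, rfl⟩)) hb
  refine ⟨(Finset.finite_toSet _).subset hsupp, ?_⟩
  rw [finsum_eq_sum_of_support_subset _ hsupp, Finset.sum_pair (by simp),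
    sub_eq_add_neg (PowerSeries.coeff n (z (some a)))]
  refine congrArg₂ (· + ·) ?_ ?_
  · rw [expL_pole_same, resL, res, HahnSeries.coeff_single_mul, one_mul,
      show (-1 - -((n : ℤ) + 1)) = n by ring, PowerSeries.coeff_coe]
    simp
  · obtain ⟨q, hq, h⟩ := expL_none_pole a (n + 1)
    rw [h, resL, res, mul_assoc, HahnSeries.coeff_single_mul, one_mul, ← map_mul,
      PowerSeries.coeff_coe]
    rcases Nat.eq_zero_or_pos n with rfl | hn
    · simp [hq]
    · rw [if_pos (by push_cast; omega), if_neg hn.ne']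

theorem HasResidueSum.X_pow (z : CP1 → PowerSeries ℂ) (n : ℕ) :
    HasResidueSum (fun b => HahnSeries.ofPowerSeries ℤ ℂ (z b)) (RatFunc.X ^ n)
      (- PowerSeries.coeff (n + 1) (z none)) := by
  have hsupp : (Function.support fun b => resL b
      (expL b ((RatFunc.X : Rf) ^ n) *
        HahnSeries.ofPowerSeries ℤ ℂ (z b))) ⊆ (({none} : Finset CP1) : Set CP1) := by
    intro b hb
    rw [Function.mem_support] at hb
    cases b with
    | none => simp
    | some b =>
      refine absurd (resL_some_of_mem b (mul_mem ?_ ⟨_, rfl⟩)) hb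
      rw [map_pow]
      exact pow_mem (expL_some_X_mem b) n
  refine ⟨(Finset.finite_toSet _).subset hsupp, ?_⟩
  rw [finsum_eq_sum_of_support_subset _ hsupp, Finset.sum_singleton, expL_none_X_pow, resL, res,
    HahnSeries.coeff_single_mul, one_mul, PowerSeries.coeff_coe, if_neg (by omega)]
  congr 3
  omega

end Residues

section PartialFractions

/-- The span of the monomials and of the principal parts. -/
def partialFractions : Submodule ℂ Rf :=
  Submodule.span ℂ (Set.range (fun n : ℕ => (RatFunc.X : Rf) ^ n) ∪
    Set.range fun p : ℂ × ℕ => (((RatFunc.X : Rf) - RatFunc.C p.1) ^ (p.2 + 1))⁻¹)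

theorem X_pow_mem_partialFractions (n : ℕ) : (RatFunc.X : Rf) ^ n ∈ partialFractions :=
  Submodule.subset_span (Or.inl ⟨n, rfl⟩)

theorem pole_mem_partialFractions (a : ℂ) (n : ℕ) :
    (((RatFunc.X : Rf) - RatFunc.C a) ^ (n + 1))⁻¹ ∈ partialFractions :=
  Submodule.subset_span (Or.inr ⟨(a, n), rfl⟩)

theorem C_mul_mem_partialFractions (c : ℂ) {g : Rf} (hg : g ∈ partialFractions) :
    RatFunc.C c * g ∈ partialFractions := by
  rw [← RatFunc.smul_eq_C_mul]
  exact Submodule.smul_mem _ _ hg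

theorem pow_succ_mul_inv_sub {K : Type*} [Field K] {x b : K} (h : x ≠ b) (n : ℕ) :
    x ^ (n + 1) * (x - b)⁻¹ = x ^ n + b * (x ^ n * (x - b)⁻¹) := by
  have := sub_ne_zero.2 h
  field_simp
  ring

theorem inv_sub_pow_succ_mul_inv_sub {K : Type*} [Field K] {x a b : K} (ha : x - a ≠ 0)
    (hb : x - b ≠ 0) (hab : a - b ≠ 0) (n : ℕ) :
    ((x - a) ^ (n + 1))⁻¹ * (x - b)⁻¹ =
      (a - b)⁻¹ * (((x - a) ^ (n + 1))⁻¹ - ((x - a) ^ n)⁻¹ * (x - b)⁻¹) := by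
  field_simp
  ring

theorem X_pow_mul_inv_mem (b : ℂ) (n : ℕ) :
    (RatFunc.X : Rf) ^ n * (RatFunc.X - RatFunc.C b)⁻¹ ∈ partialFractions := by
  induction n with
  | zero => simpa using pole_mem_partialFractions b 0
  | succ n ih =>
    have h : (RatFunc.X : Rf) ^ (n + 1) * (RatFunc.X - RatFunc.C b)⁻¹ =
        RatFunc.X ^ n + RatFunc.C b * (RatFunc.X ^ n * (RatFunc.X - RatFunc.C b)⁻¹) := by
      exact pow_succ_mul_inv_sub (sub_ne_zero.1 (ratX_sub_C_ne_zero b)) n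
    rw [h]
    exact add_mem (X_pow_mem_partialFractions n) (C_mul_mem_partialFractions b ih)

theorem pole_mul_inv_mem (a b : ℂ) (n : ℕ) :
    (((RatFunc.X : Rf) - RatFunc.C a) ^ n)⁻¹ * (RatFunc.X - RatFunc.C b)⁻¹ ∈
      partialFractions := by
  by_cases hab : a = b
  · subst hab
    rw [← mul_inv, ← pow_succ]
    exact pole_mem_partialFractions a n
  · induction n with
    | zero => simpa using pole_mem_partialFractions b 0
    | succ n ih =>
      have h : (((RatFunc.X : Rf) - RatFunc.C a) ^ (n + 1))⁻¹ * (RatFunc.X - RatFunc.C b)⁻¹ =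
          RatFunc.C (a - b)⁻¹ * ((((RatFunc.X : Rf) - RatFunc.C a) ^ (n + 1))⁻¹ -
            (((RatFunc.X : Rf) - RatFunc.C a) ^ n)⁻¹ * (RatFunc.X - RatFunc.C b)⁻¹) := by
        rw [map_inv₀, map_sub]
        exact inv_sub_pow_succ_mul_inv_sub (ratX_sub_C_ne_zero a) (ratX_sub_C_ne_zero b)
          (sub_ne_zero.2 fun h => hab (RatFunc.C_injective h)) n
      rw [h]
      exact C_mul_mem_partialFractions _ (sub_mem (pole_mem_partialFractions a n) ih)

theorem mul_inv_mem_partialFractions (b : ℂ) {g : Rf} (hg : g ∈ partialFractions) :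
    g * (RatFunc.X - RatFunc.C b)⁻¹ ∈ partialFractions := by
  induction hg using Submodule.span_induction with
  | mem x hx =>
    rcases hx with ⟨n, rfl⟩ | ⟨p, rfl⟩
    · exact X_pow_mul_inv_mem b n
    · exact pole_mul_inv_mem p.1 b (p.2 + 1)
  | zero => simp
  | add x y _ _ hx hy => rw [add_mul]; exact add_mem hx hy
  | smul c x _ hx => rw [smul_mul_assoc]; exact Submodule.smul_mem _ _ hx

theorem mem_partialFractions (g : Rf) : g ∈ partialFractions := by
  have hnum : algebraMap ℂ[X] Rf g.num ∈ partialFractions := by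
    rw [Polynomial.as_sum_range_C_mul_X_pow g.num, map_sum]
    refine sum_mem fun i _ => ?_
    rw [map_mul, map_pow, RatFunc.algebraMap_C, RatFunc.algebraMap_X]
    exact C_mul_mem_partialFractions _ (X_pow_mem_partialFractions i)
  have hprod : ∀ s : Multiset ℂ, ∀ h ∈ partialFractions,
      h * (algebraMap ℂ[X] Rf (s.map fun a => Polynomial.X - Polynomial.C a).prod)⁻¹ ∈
        partialFractions := by
    intro s
    induction s using Multiset.induction_on with
    | empty => intro h hh; simpa using hh
    | cons a s ih =>
      intro h hh
      rw [Multiset.map_cons, Multiset.prod_cons, map_mul, mul_inv, ← mul_assoc, map_sub,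
        RatFunc.algebraMap_X, RatFunc.algebraMap_C]
      exact ih _ (mul_inv_mem_partialFractions a hh)
  have hden : g.denom = (g.denom.roots.map fun a => Polynomial.X - Polynomial.C a).prod := by
    have h := (IsAlgClosed.splits g.denom).eq_prod_roots
    rwa [(RatFunc.monic_denom g).leadingCoeff, Polynomial.C_1, one_mul] at h
  rw [← RatFunc.num_div_denom g, div_eq_mul_inv, hden]
  exact hprod _ _ hnum

theorem hasResidueSum_one (g : Rf) : HasResidueSum (fun _ => 1) g 0 := by
  have h1 : (fun _ : CP1 => (1 : LaurentSeries ℂ)) =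
      fun _ => HahnSeries.ofPowerSeries ℤ ℂ 1 := by
    rw [map_one (HahnSeries.ofPowerSeries ℤ ℂ)]
  have hg := mem_partialFractions g
  induction hg using Submodule.span_induction with
  | mem x hx =>
    rw [h1]
    rcases hx with ⟨n, rfl⟩ | ⟨p, rfl⟩
    · simpa using HasResidueSum.X_pow (fun _ => 1) n
    · simpa [PowerSeries.coeff_one] using HasResidueSum.pole (fun _ => 1) p.1 p.2
  | zero => exact HasResidueSum.zero _
  | add x y _ _ hx hy => simpa using hx.add hy
  | smul c x _ hx =>
    rw [RatFunc.smul_eq_C_mul]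
    simpa using hx.C_mul c

end PartialFractions

section Symmetry

theorem X_sub_C_mul_kernelCoeff_some (a : ℂ) (t : ℤ) :
    ((RatFunc.X : Rf) - RatFunc.C a) * kernelCoeff (some a) t =
      kernelCoeff (some a) (t - 1) + RatFunc.C (if t = 0 then 1 else 0) * RatFunc.X := by
  have hne := ratX_sub_C_ne_zero a
  rcases lt_trichotomy t 0 with ht | rfl | ht
  · rw [kernelCoeff_some, kernelCoeff_some, if_pos ht, if_pos (by omega), if_neg ht.ne]
    simp
  · rw [kernelCoeff_some, kernelCoeff_some, if_neg (by omega), if_pos (by omega)]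
    simp [mul_left_comm _ (RatFunc.X : Rf), mul_inv_cancel₀ hne]
  · rw [kernelCoeff_some, kernelCoeff_some, if_neg (by omega), if_neg (by omega), if_neg ht.ne',
      map_zero, zero_mul, add_zero, mul_left_comm, show t.natAbs = (t - 1).natAbs + 1 by omega,
      pow_succ, mul_inv, mul_comm _ (RatFunc.X - RatFunc.C a)⁻¹, mul_inv_cancel_left₀ hne]

theorem kernelCoeff_none_eq (t : ℤ) :
    kernelCoeff none t =
      RatFunc.X * kernelCoeff none (t - 1) - RatFunc.C (if t = 1 then 1 else 0) * RatFunc.X := by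
  rcases lt_trichotomy t 1 with ht | rfl | ht
  · rw [kernelCoeff_none, kernelCoeff_none, if_pos (by omega), if_pos (by omega), if_neg ht.ne]
    simp
  · rw [kernelCoeff_none, kernelCoeff_none, if_neg (by omega), if_pos (by omega)]
    simp
  · rw [kernelCoeff_none, kernelCoeff_none, if_neg (by omega), if_neg (by omega), if_neg ht.ne',
      map_zero, zero_mul, sub_zero, show t.natAbs = (t - 1).natAbs + 1 by omega, pow_succ',
      mul_neg]

theorem sLamFirst_some_of_neg (a : ℂ) (b : CP1) {t : ℤ} (ht : t < 0) (m : ℤ) :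
    sLamFirst (some a) b t m = 0 := by
  rw [sLamFirst_eq, kernelCoeff_some, if_pos ht, map_zero, HahnSeries.coeff_zero]

theorem sLamFirst_none_of_nonpos (b : CP1) {t : ℤ} (ht : t ≤ 0) (m : ℤ) :
    sLamFirst none b t m = 0 := by
  rw [sLamFirst_eq, kernelCoeff_none, if_pos ht, map_zero, HahnSeries.coeff_zero]

theorem sLamFirst_of_neg {a b : CP1} (h : a ≠ b) (t : ℤ) {m : ℤ} (hm : m < 0) :
    sLamFirst a b t m = 0 := by
  rw [sLamFirst_eq]
  refine coeff_eq_zero_of_mem_taylorSubring ?_ hm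
  cases a with
  | none =>
    obtain ⟨b, rfl⟩ := Option.ne_none_iff_exists'.1 h.symm
    rw [kernelCoeff_none]
    split_ifs
    · rw [map_zero]; exact zero_mem _
    · rw [map_neg, map_pow]; exact neg_mem (pow_mem (expL_some_X_mem b) _)
  | some a =>
    rw [kernelCoeff_some]
    split_ifs
    · rw [map_zero]; exact zero_mem _
    · rw [map_mul]
      cases b with
      | some b =>
        exact mul_mem (expL_some_X_mem b) (expL_pole_of_ne (fun hb => h (by rw [hb])) _)
      | none =>
        obtain ⟨q, -, hq⟩ := expL_none_pole a (t.natAbs + 1)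
        rw [hq, expL_none_X, ← mul_assoc, HahnSeries.single_mul_single]
        refine mul_mem ⟨PowerSeries.X ^ t.natAbs, ?_⟩ ⟨q, rfl⟩
        rw [HahnSeries.ofPowerSeries_X_pow]
        congr 2
        · omega
        · simp

theorem sLamFirst_some_some_rec (a b : ℂ) (t m : ℤ) :
    sLamFirst (some a) (some b) t (m - 1) + (b - a) * sLamFirst (some a) (some b) t m =
      sLamFirst (some a) (some b) (t - 1) m +
        (if t = 0 then 1 else 0) * ((if m = 1 then 1 else 0) + b * if m = 0 then 1 else 0) := by
  have h := congrArg (fun S => (expL (some b) S).coeff m) (X_sub_C_mul_kernelCoeff_some a t)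
  simp only [map_mul, map_sub, map_add, expL_some_X, expL_C] at h
  simp only [sub_mul, add_mul, HahnSeries.coeff_add, HahnSeries.coeff_sub, HahnSeries.C_apply,
    HahnSeries.coeff_single_mul, HahnSeries.coeff_single, ← sLamFirst_eq, sub_zero] at h
  split_ifs at h ⊢ <;> linear_combination h

theorem sLamFirst_none_some_rec (b : ℂ) (t m : ℤ) :
    sLamFirst none (some b) t m =
      sLamFirst none (some b) (t - 1) (m - 1) + b * sLamFirst none (some b) (t - 1) m -
        (if t = 1 then 1 else 0) * ((if m = 1 then 1 else 0) + b * if m = 0 then 1 else 0) := by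
  have h := congrArg (fun S => (expL (some b) S).coeff m) (kernelCoeff_none_eq t)
  simp only [map_mul, map_sub, expL_some_X, expL_C, add_mul, HahnSeries.coeff_add,
    HahnSeries.coeff_sub, HahnSeries.C_apply, HahnSeries.coeff_single_mul,
    HahnSeries.coeff_single, ← sLamFirst_eq, sub_zero] at h
  split_ifs at h ⊢ <;> linear_combination h

theorem sLamFirst_some_none_rec (b : ℂ) (t m : ℤ) :
    sLamFirst (some b) none m t =
      b * sLamFirst (some b) none m (t - 1) + sLamFirst (some b) none (m - 1) (t - 1) +
        (if m = 0 then 1 else 0) * (if t = 0 then 1 else 0) := by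
  have h := congrArg (fun S => (expL none S).coeff (t - 1)) (X_sub_C_mul_kernelCoeff_some b m)
  simp only [map_mul, map_sub, map_add, expL_none_X, expL_C, sub_mul,
    HahnSeries.coeff_add, HahnSeries.coeff_sub, HahnSeries.C_apply, HahnSeries.coeff_single_mul,
    HahnSeries.coeff_single, ← sLamFirst_eq, sub_zero, sub_neg_eq_add, sub_add_cancel,
    sub_eq_neg_self, one_mul] at h
  linear_combination h

theorem eq_zero_of_rec {c : ℂ} (hc : c ≠ 0) {E : ℤ → ℤ → ℂ}
    (hrec : ∀ t m, c * E t m = E (t - 1) m - E t (m - 1)) (ht : ∀ t m, t < 0 → E t m = 0)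
    (hm : ∀ t m, m < 0 → E t m = 0) (t m : ℤ) : E t m = 0 := by
  have h : ∀ k l : ℕ, E (k - 1) (l - 1) = 0 := by
    intro k
    induction k with
    | zero => exact fun l => ht _ _ (by simp)
    | succ k ihk =>
      intro l
      induction l with
      | zero => exact hm _ _ (by simp)
      | succ l ihl =>
        have h1 := hrec k l
        have h2 := ihk (l + 1)
        push_cast at h2 ihl ⊢
        rw [add_sub_cancel_right] at h2 ihl ⊢
        rw [add_sub_cancel_right]
        rw [h2, ihl, sub_zero] at h1
        exact (mul_eq_zero.1 h1).resolve_left hc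
  rcases lt_or_ge t 0 with h0 | h0
  · exact ht _ _ h0
  rcases lt_or_ge m 0 with h1 | h1
  · exact hm _ _ h1
  have := h (t + 1).toNat (m + 1).toNat
  rwa [Int.toNat_of_nonneg (by omega), Int.toNat_of_nonneg (by omega), add_sub_cancel_right,
    add_sub_cancel_right] at this

/-- Off the diagonal, the two orders of expansion of `μ/(μ−λ)` agree. -/
theorem sLamFirst_add_sLamFirst_some_some {a b : ℂ} (hab : a ≠ b) (t m : ℤ) :
    sLamFirst (some a) (some b) t m + sLamFirst (some b) (some a) m t =
      (if m = 0 then 1 else 0) * (if t = 0 then 1 else 0) := by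
  have hne : (some a : CP1) ≠ some b := fun h => hab (Option.some_injective _ h)
  rw [← sub_eq_zero]
  refine eq_zero_of_rec (E := fun t m => sLamFirst (some a) (some b) t m +
    sLamFirst (some b) (some a) m t - (if m = 0 then 1 else 0) * (if t = 0 then 1 else 0))
    (sub_ne_zero.2 hab.symm) ?_ ?_ ?_ t m
  · intro t m
    have h1 := sLamFirst_some_some_rec a b t m
    have h2 := sLamFirst_some_some_rec b a m t
    simp only [sub_eq_zero]
    linear_combination h1 - h2
  · intro t m ht
    simp [sLamFirst_some_of_neg _ _ ht, sLamFirst_of_neg hne.symm _ ht, ht.ne]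
  · intro t m hm
    simp [sLamFirst_some_of_neg _ _ hm, sLamFirst_of_neg hne _ hm, hm.ne]

theorem sLamFirst_add_sLamFirst_none_some (b : ℂ) (t m : ℤ) :
    sLamFirst none (some b) t m + sLamFirst (some b) none m t =
      (if m = 0 then 1 else 0) * (if t = 0 then 1 else 0) := by
  have h : ∀ k : ℕ, ∀ m, sLamFirst none (some b) (k - 1) m + sLamFirst (some b) none m (k - 1) =
      (if m = 0 then 1 else 0) * (if (k - 1 : ℤ) = 0 then 1 else 0) := by
    intro k
    induction k with
    | zero =>
      intro m
      rw [sLamFirst_none_of_nonpos _ (by simp), sLamFirst_of_neg (by simp) _ (by simp)]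
      simp
    | succ k ih =>
      intro m
      have h1 := sLamFirst_none_some_rec b k m
      have h2 := sLamFirst_some_none_rec b k m
      have h3 := ih m
      have h4 := ih (m - 1)
      simp only [sub_eq_zero] at h3 h4
      push_cast
      rw [add_sub_cancel_right]
      linear_combination h1 + h2 + b * h3 + h4
  rcases lt_or_ge t 0 with h0 | h0
  · rw [sLamFirst_none_of_nonpos _ h0.le, sLamFirst_of_neg (by simp) _ h0, if_neg h0.ne]
    simp
  have := h (t + 1).toNat m
  rwa [Int.toNat_of_nonneg (by omega), add_sub_cancel_right] at this

/-- The difference of the two orders of expansion of `μ/(μ−λ)` at the same point. -/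
def kernelDiag (a : CP1) (t : ℤ) : LaurentSeries ℂ :=
  match a with
  | some a => (HahnSeries.single 1 1 + HahnSeries.C a) * HahnSeries.single (-t - 1) 1
  | none => HahnSeries.single (-t) (-1)

theorem sLamFirst_add_sLamFirst_self (a : CP1) (t m : ℤ) :
    sLamFirst a a t m + sLamFirst a a m t =
      (if m = 0 then 1 else 0) * (if t = 0 then 1 else 0) + (kernelDiag a t).coeff m := by
  cases a with
  | none =>
    have h : ∀ t m, sLamFirst none none t m = if t ≤ 0 then 0 else if m = -t then -1 else 0 := by
      intro t m
      rw [sLamFirst_eq, kernelCoeff_none]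
      split_ifs with ht
      · simp
      all_goals
        rw [map_neg, expL_none_X_pow, HahnSeries.coeff_neg, HahnSeries.coeff_single]
        first
        | rw [if_pos (by omega)]
        | rw [if_neg (by omega), neg_zero]
    rw [h, h, kernelDiag, HahnSeries.coeff_single]
    grind
  | some a =>
    have h : ∀ t m, sLamFirst (some a) (some a) t m =
        if t < 0 then 0 else (if m = -t then 1 else 0) + a * if m = -t - 1 then 1 else 0 := by
      intro t m
      rw [sLamFirst_eq, kernelCoeff_some]
      split_ifs with ht
      · simp
      all_goals
        rw [map_mul, expL_some_X, expL_pole_same, add_mul]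
        simp only [HahnSeries.coeff_add, HahnSeries.C_apply, HahnSeries.coeff_single_mul,
          HahnSeries.coeff_single, sub_zero, one_mul]
        grind
    rw [h, h, kernelDiag, add_mul]
    simp only [HahnSeries.coeff_add, HahnSeries.C_apply, HahnSeries.coeff_single_mul,
      HahnSeries.coeff_single, sub_zero, one_mul]
    grind

theorem sMuFirst_eq_coeff (a b : CP1) (t m : ℤ) :
    sMuFirst a b t m =
      (expL b (kernelCoeff a t) - if a = b then kernelDiag a t else 0).coeff m := by
  have h : sLamFirst a b t m + sLamFirst b a m t =
      (if m = 0 then 1 else 0) * (if t = 0 then 1 else 0) +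
        (if a = b then kernelDiag a t else 0).coeff m := by
    by_cases hab : a = b
    · subst hab
      simpa using sLamFirst_add_sLamFirst_self a t m
    · rw [if_neg hab, HahnSeries.coeff_zero, add_zero]
      cases a with
      | none =>
        obtain ⟨b, rfl⟩ := Option.ne_none_iff_exists'.1 (Ne.symm hab)
        exact sLamFirst_add_sLamFirst_none_some b t m
      | some a =>
        cases b with
        | none =>
          rw [add_comm, mul_comm]
          exact sLamFirst_add_sLamFirst_none_some a m t
        | some b =>
          exact sLamFirst_add_sLamFirst_some_some (fun h => hab (by rw [h])) t m
  rw [sMuFirst_eq, HahnSeries.coeff_sub, ← sLamFirst_eq]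
  have h' : (if m = 0 ∧ t = 0 then (1 : ℂ) else 0) =
      (if m = 0 then 1 else 0) * (if t = 0 then 1 else 0) := by
    rw [ite_and]
    split_ifs <;> simp
  rw [h']
  linear_combination -h

end Symmetry

section Projections

theorem HasResidueSum.add_expL {Z : CP1 → LaurentSeries ℂ} {G : Rf} {v : ℂ}
    (h : HasResidueSum Z G v) (g : Rf) : HasResidueSum (fun b => Z b + expL b g) G v := by
  have h1 := hasResidueSum_one (G * g)
  have h2 : (fun b => resL b (expL b G * (Z b + expL b g))) = fun b =>
      resL b (expL b G * Z b) + resL b (expL b (G * g) * 1) := by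
    funext b
    rw [mul_add, resL_add, map_mul, mul_one]
  refine ⟨?_, ?_⟩
  · rw [h2]
    exact (h.1.union h1.1).subset (Function.support_add _ _)
  · rw [h2, finsum_add_distrib h.1 h1.1, h.2, h1.2, add_zero]

theorem hasResidueSum_kernelCoeff (y : CP1 → PowerSeries ℂ) (c : ℂ)
    (hc : c * (PowerSeries.coeff 0 (y (some 0)) - PowerSeries.coeff 0 (y none)) =
      - PowerSeries.coeff 0 (y none)) (a : CP1) (t : ℤ) :
    HasResidueSum (fun b => HahnSeries.ofPowerSeries ℤ ℂ (y b))
      (RatFunc.X⁻¹ * (kernelCoeff a t - RatFunc.C (if t = 0 then c else 0)))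
      ((HahnSeries.ofPowerSeries ℤ ℂ (y a)).coeff t) := by
  have hX : (RatFunc.X : Rf) ≠ 0 := RatFunc.X_ne_zero
  have hpole := (HasResidueSum.pole y 0 0).C_mul (-c)
  simp only [if_true, map_zero, sub_zero, zero_add, pow_one] at hpole
  rw [PowerSeries.coeff_coe]
  rcases lt_trichotomy t 0 with ht | rfl | ht
  · have h : kernelCoeff a t = 0 := by
      cases a with
      | none => rw [kernelCoeff_none, if_pos ht.le]
      | some a => rw [kernelCoeff_some, if_pos ht]
    rw [h, if_pos ht, if_neg ht.ne, map_zero, sub_zero, mul_zero]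
    exact HasResidueSum.zero _
  · rw [if_pos rfl, if_neg (lt_irrefl _), Int.natAbs_zero, mul_sub, sub_eq_add_neg]
    have h1 : -((RatFunc.X : Rf)⁻¹ * RatFunc.C c) = RatFunc.C (-c) * RatFunc.X⁻¹ := by
      rw [map_neg, neg_mul, mul_comm]
    rw [h1]
    cases a with
    | none =>
      rw [kernelCoeff_none, if_pos le_rfl, mul_zero, zero_add]
      convert hpole using 1
      rw [← PowerSeries.coeff_zero_eq_constantCoeff_apply]
      linear_combination hc
    | some a =>
      rw [kernelCoeff_some, if_neg (lt_irrefl _), inv_mul_cancel_left₀ hX, Int.natAbs_zero]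
      convert (HasResidueSum.pole y a 0).add hpole using 1
      rw [if_pos rfl, ← PowerSeries.coeff_zero_eq_constantCoeff_apply]
      linear_combination hc
  · rw [if_neg ht.not_gt, if_neg ht.ne', map_zero, sub_zero]
    cases a with
    | none =>
      obtain ⟨n, rfl⟩ : ∃ n : ℕ, t = n + 1 := ⟨(t - 1).toNat, by omega⟩
      have h := (HasResidueSum.X_pow y n).C_mul (-1)
      rw [kernelCoeff_none, if_neg (by omega)]
      convert h using 1
      · rw [show ((n : ℤ) + 1).natAbs = n + 1 by omega, pow_succ', mul_neg,
          inv_mul_cancel_left₀ hX, map_neg, map_one, neg_one_mul]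
      · rw [show ((n : ℤ) + 1).natAbs = n + 1 by omega, neg_one_mul, neg_neg]
    | some a =>
      rw [kernelCoeff_some, if_neg ht.not_gt, inv_mul_cancel_left₀ hX]
      convert HasResidueSum.pole y a t.natAbs using 1
      rw [if_neg (by omega), sub_zero]

theorem resL_kernelDiag (a : CP1) (t : ℤ) (S : LaurentSeries ℂ) :
    resL a (expL a RatFunc.X⁻¹ * (kernelDiag a t * S)) = S.coeff t := by
  have hX : expL a RatFunc.X⁻¹ * expL a RatFunc.X = 1 := by
    rw [← map_mul, inv_mul_cancel₀ RatFunc.X_ne_zero, map_one]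
  cases a with
  | none =>
    rw [map_inv₀, expL_none_X, HahnSeries.inv_single, kernelDiag, resL, res,
      HahnSeries.coeff_single_mul, HahnSeries.coeff_single_mul]
    simp
  | some a =>
    rw [kernelDiag, ← expL_some_X, mul_assoc, ← mul_assoc, hX, one_mul, resL, res,
      HahnSeries.coeff_single_mul, one_mul]
    congr 1
    ring

theorem finsum_matrix_apply {ι m n R : Type*} [Finite m] [Finite n] [AddCommMonoid R]
    {f : ι → Matrix m n R} (hf : ∀ i j, (Function.support fun b => f b i j).Finite) (i : m)
    (j : n) : (∑ᶠ b, f b) i j = ∑ᶠ b, f b i j := by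
  refine (Matrix.entryAddMonoidHom R i j).map_finsum ?_
  refine (Set.finite_iUnion fun i => Set.finite_iUnion fun j => hf i j).subset fun b hb => ?_
  by_contra h
  simp only [Set.mem_iUnion, Function.mem_support, not_exists, not_not] at h
  exact hb (Matrix.ext h)

theorem coeff_mul_eq_finsum (A S : LaurentSeries ℂ) (m : ℤ) :
    (Function.support fun p => A.coeff p * S.coeff (m - p)).Finite ∧
      ∑ᶠ p, A.coeff p * S.coeff (m - p) = (A * S).coeff m := by
  set D := Finset.antidiagonal A.isPWO_support S.isPWO_support m with hD
  have hsub : (Function.support fun p => A.coeff p * S.coeff (m - p)) ⊆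
      (D.image Prod.fst : Finset ℤ) := by
    intro p hp
    rw [Function.mem_support] at hp
    rw [Finset.mem_coe, Finset.mem_image]
    refine ⟨(p, m - p), ?_, rfl⟩
    rw [hD, Finset.mem_antidiagonal]
    exact ⟨left_ne_zero_of_mul hp, right_ne_zero_of_mul hp, by simp⟩
  refine ⟨(Finset.finite_toSet _).subset hsub, ?_⟩
  have hadd : ∀ p ∈ D, p.2 = m - p.1 := fun p hp => by
    rw [hD, Finset.mem_antidiagonal] at hp
    have := hp.2.2
    omega
  rw [finsum_eq_sum_of_support_subset _ hsub, HahnSeries.coeff_mul, Finset.sum_image]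
  · exact Finset.sum_congr rfl fun p hp => by rw [hadd p hp]
  · intro p hp q hq h
    exact Prod.ext h (by rw [hadd p hp, hadd q hq, h])

theorem finsum_smul_apply {N : ℕ} (A : LaurentSeries ℂ) {M : ℤ → glC N}
    {S : Fin N → Fin N → LaurentSeries ℂ} (h : ∀ m i j, M m i j = (S i j).coeff m) (m : ℤ)
    (i j : Fin N) : (∑ᶠ p, A.coeff p • M (m - p)) i j = (A * S i j).coeff m := by
  rw [finsum_matrix_apply fun i j => ?_]
  · simp only [Matrix.smul_apply, smul_eq_mul, h]
    exact (coeff_mul_eq_finsum _ _ _).2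
  · simp only [Matrix.smul_apply, smul_eq_mul, h]
    exact (coeff_mul_eq_finsum _ _ _).1

/-- The eigenvalue of `P⁻ + ½P⁰` on the matrix unit `E_{ij}`. -/
def trigConst {N : ℕ} (i j : Fin N) : ℂ := if j < i then 1 else if i = j then 2⁻¹ else 0

theorem lowP_add_diagP_apply {N : ℕ} (M : glC N) (i j : Fin N) :
    (lowP M + (2 : ℂ)⁻¹ • diagP M) i j = trigConst i j * M i j := by
  simp only [lowP, diagP, trigConst, Matrix.add_apply, Matrix.smul_apply, Matrix.of_apply]
  split_ifs with h1 h2 <;> simp_all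

theorem res_finsum_apply {N : ℕ} (b : CP1) (K : LaurentSeries ℂ) {M : ℤ → glC N}
    {S : Fin N → Fin N → LaurentSeries ℂ} (h : ∀ m i j, M m i j = (S i j).coeff m) (t : ℤ)
    (i j : Fin N) :
    res b (fun m : ℤ => ∑ᶠ p : ℤ, expC b ((RatFunc.X : Rf)⁻¹) p •
      ((∑ᶠ q : ℤ, K.coeff q • M (m - p - q)) -
        if t = 0 then lowP (M (m - p)) + (2 : ℂ)⁻¹ • diagP (M (m - p)) else 0)) i j =
    resL b (expL b RatFunc.X⁻¹ *
      ((K - HahnSeries.C (if t = 0 then trigConst i j else 0)) * S i j)) := by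
  have h1 : ∀ m i j, ((∑ᶠ q : ℤ, K.coeff q • M (m - q)) -
      if t = 0 then lowP (M m) + (2 : ℂ)⁻¹ • diagP (M m) else 0) i j =
      ((K - HahnSeries.C (if t = 0 then trigConst i j else 0)) * S i j).coeff m := by
    intro m i j
    rw [Matrix.sub_apply, finsum_smul_apply K h, sub_mul, HahnSeries.coeff_sub,
      HahnSeries.C_apply, HahnSeries.coeff_single_mul, sub_zero, ← h]
    split_ifs
    · rw [lowP_add_diagP_apply]
    · simp
  have h2 := fun m => finsum_smul_apply (expL b RatFunc.X⁻¹) h1 m i j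
  simp only [← expC_eq_coeff] at h2
  cases b with
  | some b => exact h2 (-1)
  | none => exact congrArg Neg.neg (h2 1)

end Projections

/-- for any adelic element `X` and any decomposition `X = Y + ι_λ f`
with `Y ∈ A^trig_λ(g)` and `f` rational, the two summands (the projections `π^trig₊X`
and `π^trig₋X`) are given by the residue formulas. -/
theorem trigonometric_projection_formulas (N : ℕ) (X : AdeleData N) (hX : IsAdele X)
    (Y : AdeleData N) (f : Matrix (Fin N) (Fin N) Rf)
    (hY : InAtrig Y) (hdec : ∀ a n, X a n = Y a n + iota f a n) :
    (∀ (a : CP1) (t : ℤ), Y a t = projPlusTrigRHS X a t) ∧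
    (∀ (a : CP1) (t : ℤ), iota f a t = projMinusTrigRHS X a t) := by
  set y : Fin N → Fin N → CP1 → PowerSeries ℂ := fun i j b => PowerSeries.mk fun n => Y b n i j
    with hy
  set Z : CP1 → Fin N → Fin N → LaurentSeries ℂ :=
    fun b i j => HahnSeries.ofPowerSeries ℤ ℂ (y i j b) + expL b (f i j) with hZ
  have hYy : ∀ b n i j, Y b n i j = (HahnSeries.ofPowerSeries ℤ ℂ (y i j b)).coeff n := by
    intro b n i j
    rw [PowerSeries.coeff_coe]
    split_ifs with hn
    · rw [hY.1 b n hn, Matrix.zero_apply]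
    · rw [hy, PowerSeries.coeff_mk, Int.natAbs_of_nonneg (not_lt.1 hn)]
  have hXZ : ∀ b n i j, X b n i j = (Z b i j).coeff n := by
    intro b n i j
    rw [hdec, Matrix.add_apply, hYy, iota, Matrix.of_apply, expC_eq_coeff, HahnSeries.coeff_add]
  have hsum : ∀ a t i j, HasResidueSum (fun b => Z b i j)
      (RatFunc.X⁻¹ * (kernelCoeff a t - RatFunc.C (if t = 0 then trigConst i j else 0)))
      (Y a t i j) := by
    intro a t i j
    have hc : trigConst i j * (Y (some 0) 0 i j - Y none 0 i j) = - Y none 0 i j := by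
      obtain ⟨-, hlow, hup, hdiag⟩ := hY
      have hlow := congrFun₂ hlow i j
      have hup := congrFun₂ hup i j
      have hdiag := congrFun₂ hdiag i j
      simp only [lowP, upP, diagP, Matrix.of_apply, Matrix.zero_apply, Matrix.neg_apply]
        at hlow hup hdiag
      rw [trigConst]
      rcases lt_trichotomy j i with h | h | h
      · rw [if_pos h] at hlow ⊢
        rw [hlow]
        ring
      · rw [if_pos h.symm, if_pos h.symm] at hdiag
        rw [if_neg h.not_lt, if_pos h.symm, hdiag]
        ring
      · rw [if_pos h] at hup
        rw [if_neg h.not_gt, if_neg h.ne, hup]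
        ring
    rw [hYy]
    refine (hasResidueSum_kernelCoeff (y i j) (trigConst i j) ?_ a t).add_expL (f i j)
    simpa [hy] using hc
  have hexp : ∀ a t b i j, expL b RatFunc.X⁻¹ * ((expL b (kernelCoeff a t) -
      HahnSeries.C (if t = 0 then trigConst i j else 0)) * Z b i j) = expL b (RatFunc.X⁻¹ *
        (kernelCoeff a t - RatFunc.C (if t = 0 then trigConst i j else 0))) * Z b i j := by
    intro a t b i j
    rw [map_mul, map_sub, expL_C, mul_assoc]
  refine ⟨fun a t => ?_, fun a t => ?_⟩
  · have hterm := fun b i j => res_finsum_apply b (expL b (kernelCoeff a t)) (hXZ b) t i j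
    simp only [hexp, ← sLamFirst_eq] at hterm
    ext i j
    rw [← (hsum a t i j).2, projPlusTrigRHS]
    simp only [trigIntP]
    rw [finsum_matrix_apply fun i j => ?_]
    · simp only [hterm]
    · simpa only [hterm] using (hsum a t i j).1
  · have hterm : ∀ b i j, res b (fun m : ℤ => ∑ᶠ p : ℤ, expC b ((RatFunc.X : Rf)⁻¹) p •
        trigIntM X a b t (m - p)) i j =
        resL b (expL b (RatFunc.X⁻¹ * (kernelCoeff a t -
          RatFunc.C (if t = 0 then trigConst i j else 0))) * Z b i j) +
        if b = a then -X a t i j else 0 := by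
      intro b i j
      have h := res_finsum_apply b (expL b (kernelCoeff a t) - if a = b then kernelDiag a t else 0)
        (hXZ b) t i j
      simp only [← sMuFirst_eq_coeff] at h
      refine h.trans ?_
      rw [sub_right_comm, sub_mul, mul_sub, hexp, sub_eq_add_neg, resL_add]
      congr 1
      split_ifs with hab hba hba
      · subst hab
        rw [← neg_one_mul, ← map_one HahnSeries.C, ← map_neg, resL_C_mul, resL_kernelDiag, hXZ,
          neg_one_mul]
      · exact absurd hab.symm hba
      · exact absurd hba.symm hab
      · cases b <;> simp [resL, res]
    have hsupp : ∀ i j, (Function.support fun b : CP1 => if b = a then -X a t i j else 0).Finite :=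
      fun i j => (Set.finite_singleton a).subset fun b hb => by
        by_contra h
        exact hb (if_neg h)
    ext i j
    rw [projMinusTrigRHS, Matrix.neg_apply, finsum_matrix_apply fun i j => ?_]
    · simp only [hterm]
      rw [finsum_add_distrib (hsum a t i j).1 (hsupp i j), (hsum a t i j).2,
        finsum_eq_single _ a fun b hb => if_neg hb, if_pos rfl, hdec, Matrix.add_apply]
      ring
    · simp only [hterm]
      exact ((hsum a t i j).1.union (hsupp i j)).subset (Function.support_add _ _)

end
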